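/- Let f : ℝᵐ → ℝ (with ℝᵐ as EuclideanSpace ℝ (Fin m)) be strictly convex on all of ℝᵐ and continuous, and let g : ℝ → ℝ be a strictly monotone increasing surjection. If g ∘ f attains its infimum, i.e., there exists x₀ with g(f(x₀)) ≤ g(f(x)) for all x, then for every α ∈ ℝ the sub-level set L_α(g ∘ f) = {x : g(f(x)) ≤ α} is compact. -/

import Mathlib

/-- A strictly convex continuous function on a proper normed space which attains its minimum
has compact sub-level sets. -/
theorem StrictConvexOn.isCompact_sublevel {E : Type*} [NormedAddCommGroup E] [NormedSpace ℝ E]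
    [ProperSpace E] {f : E → ℝ} (hf : StrictConvexOn ℝ Set.univ f) (hc : Continuous f)
    {x₀ : E} (hmin : ∀ x, f x₀ ≤ f x) (c : ℝ) : IsCompact {x | f x ≤ c} := by
  obtain ⟨a, ha, hle⟩ : ∃ a, f x₀ < a ∧ ∀ y ∈ Metric.sphere x₀ 1, a ≤ f y := by
    refine (isCompact_sphere x₀ 1).exists_forall_le' hc.continuousOn fun y hy ↦ ?_
    refine lt_of_le_of_ne (hmin y) fun h ↦ ?_
    have hxy : x₀ = y := hf.eq_of_isMinOn (fun z _ ↦ hmin z) (fun z _ ↦ h ▸ hmin z)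
      (Set.mem_univ _) (Set.mem_univ _)
    simp [← hxy] at hy
  have hδ : 0 < a - f x₀ := sub_pos.2 ha
  refine (isCompact_closedBall x₀ (max 1 ((c - f x₀) / (a - f x₀)))).of_isClosed_subset
    (isClosed_le hc continuous_const) fun x (hx : f x ≤ c) ↦ ?_
  rw [Metric.mem_closedBall, dist_eq_norm, le_max_iff, or_iff_not_imp_left, not_le,
    le_div_iff₀ hδ]
  intro hr
  have hr0 : 0 < ‖x - x₀‖ := one_pos.trans hr
  have hconv := hf.convexOn.2 (Set.mem_univ x₀) (Set.mem_univ x)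
    (sub_nonneg.2 (inv_le_one_of_one_le₀ hr.le)) (inv_nonneg.2 hr0.le) (sub_add_cancel _ _)
  have hsphere : (1 - ‖x - x₀‖⁻¹) • x₀ + ‖x - x₀‖⁻¹ • x ∈ Metric.sphere x₀ 1 := by
    have heq : (1 - ‖x - x₀‖⁻¹) • x₀ + ‖x - x₀‖⁻¹ • x - x₀ = ‖x - x₀‖⁻¹ • (x - x₀) := by
      module
    rw [mem_sphere_iff_norm, heq, norm_smul, norm_inv, norm_norm, inv_mul_cancel₀ hr0.ne']
  have hslope : a - f x₀ ≤ ‖x - x₀‖⁻¹ * (f x - f x₀) := by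
    have := (hle _ hsphere).trans hconv
    simp only [smul_eq_mul] at this
    linarith
  rw [le_inv_mul_iff₀ hr0] at hslope
  linarith

/-- If `f` is strictly convex and continuous, `g` is a strictly monotone increasing
surjection and `g ∘ f` attains its infimum, then all sub-level sets of `g ∘ f` are
compact. -/
theorem isCompact_sublevel_comp {m : ℕ}
    (f : EuclideanSpace ℝ (Fin m) → ℝ)
    (hf_conv : StrictConvexOn ℝ Set.univ f) (hf_cont : Continuous f)
    (g : ℝ → ℝ) (hg_mono : StrictMono g) (hg_surj : Function.Surjective g)
    (hmin : ∃ x₀ : EuclideanSpace ℝ (Fin m), ∀ x, g (f x₀) ≤ g (f x)) :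
    ∀ α : ℝ, IsCompact {x : EuclideanSpace ℝ (Fin m) | g (f x) ≤ α} := by
  intro α
  obtain ⟨x₀, hx₀⟩ := hmin
  obtain ⟨c, rfl⟩ := hg_surj α
  simp only [hg_mono.le_iff_le] at hx₀ ⊢
  exact hf_conv.isCompact_sublevel hf_cont hx₀ c
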